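/- Let R = F_p[x, x^{-1}] be the ring of Laurent polynomials over the field with p elements, and let k ≥ 1 and a ≥ 1 be integers. The number of R-submodules M of R^k with dim_{F_p}(R^k / M) = a equals p^{ak} − p^{(a−1)k}. For a = 0 the only such submodule is R^k itself. -/

import Mathlib

open LaurentPolynomial

section Transitivity

variable {K Q V : Type*} [Field K] [AddCommGroup Q] [Module K Q] [AddCommGroup V] [Module K V]

/-- The linear automorphisms of `V` act transitively on the embeddings into `V` of a
finite-dimensional space. -/
theorem LinearMap.exists_linearEquiv_comp_eq_of_injective [Module.Finite K Q] {f g : Q →ₗ[K] V}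
    (hf : Function.Injective f) (hg : Function.Injective g) :
    ∃ e : V ≃ₗ[K] V, ∀ q, e (f q) = g q := by
  obtain ⟨e, he⟩ := Submodule.exists_linearEquiv_restrict_eq
    ((LinearEquiv.ofInjective f hf).symm ≪≫ₗ LinearEquiv.ofInjective g hg)
  refine ⟨e, fun q => ?_⟩
  have h := he (LinearEquiv.ofInjective f hf q)
  simpa using h.symm

/-- If `Q` embeds in the finite-dimensional space `V` and `S` is an injective endomorphism of `Q`,
then the pairs of an automorphism `T` of `V` and an embedding `f : Q → V` with `f ∘ S = T ∘ f` are
equinumerous with the automorphisms of `V`. -/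
theorem nonempty_equivariant_embedding_equiv [Module.Finite K V]
    (h : Module.rank K Q ≤ (Module.finrank K V : Cardinal)) {S : Q →ₗ[K] Q}
    (hS : Function.Injective S) :
    Nonempty ({x : (V ≃ₗ[K] V) × (Q →ₗ[K] V) //
      Function.Injective x.2 ∧ ∀ q, x.2 (S q) = x.1 (x.2 q)} ≃ (V ≃ₗ[K] V)) := by
  have : Module.Finite K Q := Module.rank_lt_aleph0_iff.1 (h.trans_lt Cardinal.natCast_lt_aleph0)
  obtain ⟨i, hi⟩ := Module.Free.exists_linearMap_injective_of_linearIndependent_of_lift_rank_le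
    (M := Q) (Module.finBasis K V).linearIndependent (by simpa using h)
  choose c hc using fun f : {f : Q →ₗ[K] V // Function.Injective f} =>
    LinearMap.exists_linearEquiv_comp_eq_of_injective hi f.2
  have hc' (f) (q) : (c f).symm (f.1 q) = i q := by rw [← hc, LinearEquiv.symm_apply_apply]
  let s (f : {f : Q →ₗ[K] V // Function.Injective f}) :
      {f : Q →ₗ[K] V // Function.Injective f} := ⟨f.1 ∘ₗ S, f.2.comp hS⟩
  let r (T : V ≃ₗ[K] V) : {f : Q →ₗ[K] V // Function.Injective f} :=
    ⟨T.toLinearMap ∘ₗ i, T.injective.comp hi⟩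
  refine ⟨{
    toFun x := c ⟨x.1.2, x.2.1⟩ * (c (s ⟨x.1.2, x.2.1⟩))⁻¹ * x.1.1 * c ⟨x.1.2, x.2.1⟩
    invFun T := ⟨(c (s (r T)) * (c (r T))⁻¹ * T * (c (r T))⁻¹, (r T).1), (r T).2, fun q => ?_⟩
    left_inv := ?_
    right_inv T := ?_ }⟩
  · have h1 : c (s (r T)) (i q) = (r T).1 (S q) := hc _ _
    have h2 : (c (r T))⁻¹ ((r T).1 q) = i q := hc' _ _
    have h3 : (c (r T))⁻¹ (T (i q)) = i q := hc' (r T) _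
    simp only [LinearEquiv.mul_apply]
    rw [h2, h3, h1]
  · rintro ⟨⟨T, f⟩, hf, hT⟩
    dsimp only at hf hT ⊢
    have key : r (c ⟨f, hf⟩ * (c (s ⟨f, hf⟩))⁻¹ * T * c ⟨f, hf⟩) = ⟨f, hf⟩ := by
      ext q
      have h1 : c ⟨f, hf⟩ (i q) = f q := hc _ _
      have h2 : (c (s ⟨f, hf⟩))⁻¹ (f (S q)) = i q := hc' (s ⟨f, hf⟩) q
      change c ⟨f, hf⟩ ((c (s ⟨f, hf⟩))⁻¹ (T (c ⟨f, hf⟩ (i q)))) = f q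
      rw [h1, ← hT, h2, h1]
    simp only [key, Subtype.mk.injEq, Prod.mk.injEq, and_true]
    group
  · change c (r T) * (c (s (r T)))⁻¹ * (c (s (r T)) * (c (r T))⁻¹ * T * (c (r T))⁻¹) * c (r T) = T
    group

end Transitivity

section Laurent

variable {K V : Type*} [Field K] [AddCommGroup V] [Module K V]

/-- The action of Laurent polynomials on `V` in which the variable acts as `e`. -/
noncomputable def laurentAction (e : V ≃ₗ[K] V) : K[T;T⁻¹] →ₐ[K] Module.End K V :=
  AddMonoidAlgebra.lift K (Module.End K V) ℤ
    ((LinearEquiv.automorphismGroup.toLinearMapMonoidHom).comp (zpowersHom (V ≃ₗ[K] V) e))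

theorem laurentAction_T (e : V ≃ₗ[K] V) (n : ℤ) (v : V) :
    laurentAction e (T n) v = (e ^ n) v := by
  rw [laurentAction, T, AddMonoidAlgebra.lift_single, one_smul]
  rfl

theorem laurentAction_T_one_mul (e : V ≃ₗ[K] V) (f : K[T;T⁻¹]) (v : V) :
    laurentAction e (T 1 * f) v = e (laurentAction e f v) := by
  rw [map_mul, Module.End.mul_apply, laurentAction_T, zpow_one]

variable {N : Type*} [AddCommGroup N] [Module K N] [Module K[T;T⁻¹] N]
  [IsScalarTower K K[T;T⁻¹] N]

theorem map_smul_eq_laurentAction {e : V ≃ₗ[K] V} {f : N →ₗ[K] V}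
    (h : ∀ m, f ((T 1 : K[T;T⁻¹]) • m) = e (f m)) (r : K[T;T⁻¹]) (m : N) :
    f (r • m) = laurentAction e r (f m) := by
  have hT (n : ℤ) : ∀ m, f ((T n : K[T;T⁻¹]) • m) = (e ^ n) (f m) := by
    induction n with
    | zero => simp
    | succ n ih =>
      intro m
      rw [add_comm, T_add, mul_smul, h, ih, zpow_add, zpow_one, LinearEquiv.mul_apply]
    | pred n ih =>
      intro m
      apply e.injective
      rw [← h, ← mul_smul, ← T_add, ← LinearEquiv.mul_apply, ← zpow_one_add,
        add_sub_cancel, ih]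
  induction r using LaurentPolynomial.induction_on' with
  | add p q hp hq => simp [add_smul, hp, hq]
  | C_mul_T n a =>
    rw [← smul_eq_C_mul, smul_assoc, map_smul f, map_smul (laurentAction e), hT, LinearMap.smul_apply,
      laurentAction_T]

variable (K V N) in
/-- Pairs of an automorphism of `V` and a map `N → V` under which the variable acts by it. -/
def LaurentMap : Type _ :=
  {x : (V ≃ₗ[K] V) × (N →ₗ[K] V) // ∀ m, x.2 ((T 1 : K[T;T⁻¹]) • m) = x.1 (x.2 m)}

/-- The kernel of an equivariant map, as a module over Laurent polynomials. -/
def LaurentMap.ker (x : LaurentMap K V N) : Submodule K[T;T⁻¹] N where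
  carrier := {m | x.1.2 m = 0}
  add_mem' {a b} ha hb := by simp_all
  zero_mem' := by simp
  smul_mem' r m hm := by
    simp only [Set.mem_ofPred_eq] at hm ⊢
    rw [map_smul_eq_laurentAction x.2, hm, map_zero]

theorem LaurentMap.mem_ker {x : LaurentMap K V N} {m : N} : m ∈ x.ker ↔ x.1.2 m = 0 := Iff.rfl

theorem LaurentMap.rank_quotient_ker_le [Module.Finite K V] (x : LaurentMap K V N) :
    Module.rank K (N ⧸ x.ker.restrictScalars K) ≤ (Module.finrank K V : Cardinal) := by
  have hk : x.ker.restrictScalars K = LinearMap.ker x.1.2 := by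
    ext m; rfl
  have h := LinearMap.lift_rank_le_of_injective
    ((x.ker.restrictScalars K).liftQ x.1.2 hk.le) (by
      rw [← LinearMap.ker_eq_bot]
      exact Submodule.ker_liftQ_eq_bot _ _ _ hk.ge)
  rw [← Module.finrank_eq_rank K V, Cardinal.lift_natCast] at h
  simpa using h

/-- Equivariant maps with kernel `M` are the equivariant embeddings of the quotient by `M`. -/
noncomputable def laurentMapFiberEquiv (M : Submodule K[T;T⁻¹] N) :
    {x : LaurentMap K V N // x.ker = M} ≃
      {x : (V ≃ₗ[K] V) × ((N ⧸ M) →ₗ[K] V) // Function.Injective x.2 ∧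
        ∀ q, x.2 (LinearMap.lsmul K[T;T⁻¹] (N ⧸ M) (T 1) q) = x.1 (x.2 q)} where
  toFun x := ⟨(x.1.1.1, (M.restrictScalars K).liftQ x.1.1.2
      (fun m hm => by simpa [← x.2, LaurentMap.mem_ker] using hm) ∘ₗ
      (Submodule.Quotient.restrictScalarsEquiv K M).symm.toLinearMap), by
    constructor
    · rw [injective_iff_map_eq_zero]
      intro q hq
      obtain ⟨m, rfl⟩ := M.mkQ_surjective q
      rw [Submodule.mkQ_apply, Submodule.Quotient.mk_eq_zero, ← x.2]
      exact hq
    · intro q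
      obtain ⟨m, rfl⟩ := M.mkQ_surjective q
      exact x.1.2 m⟩
  invFun y := ⟨⟨(y.1.1, y.1.2 ∘ₗ M.mkQ.restrictScalars K), fun m => y.2.2 (M.mkQ m)⟩, by
    ext m
    change y.1.2 (M.mkQ m) = 0 ↔ _
    rw [map_eq_zero_iff _ y.2.1, Submodule.mkQ_apply, Submodule.Quotient.mk_eq_zero]⟩
  left_inv x := rfl
  right_inv y := by
    refine Subtype.ext (Prod.ext rfl (LinearMap.ext fun q => ?_))
    obtain ⟨m, rfl⟩ := M.mkQ_surjective q
    rfl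

theorem nonempty_laurentMap_equiv [Module.Finite K V] :
    Nonempty (LaurentMap K V N ≃ {M : Submodule K[T;T⁻¹] N //
      Module.rank K (N ⧸ M.restrictScalars K) ≤ (Module.finrank K V : Cardinal)} ×
        (V ≃ₗ[K] V)) := by
  have h (M : {M : Submodule K[T;T⁻¹] N //
      Module.rank K (N ⧸ M.restrictScalars K) ≤ (Module.finrank K V : Cardinal)}) :
      Nonempty ({x : LaurentMap K V N // x.ker = M.1} ≃ (V ≃ₗ[K] V)) := by
    have hM : Module.rank K (N ⧸ M.1) ≤ (Module.finrank K V : Cardinal) :=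
      (Submodule.Quotient.restrictScalarsEquiv K M.1).rank_eq ▸ M.2
    obtain ⟨e⟩ := nonempty_equivariant_embedding_equiv hM
      (S := (LinearMap.lsmul K[T;T⁻¹] (N ⧸ M.1) (T 1)).restrictScalars K)
      (fun a b hab => by
        exact (isUnit_T (R := K) 1).smul_left_cancel.1 hab)
    exact ⟨(laurentMapFiberEquiv M.1).trans e⟩
  let e M := (h M).some
  exact ⟨(Equiv.sigmaFiberEquiv fun x : LaurentMap K V N =>
      (⟨x.ker, x.rank_quotient_ker_le⟩ : {M : Submodule K[T;T⁻¹] N //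
        Module.rank K (N ⧸ M.restrictScalars K) ≤ (Module.finrank K V : Cardinal)})).symm.trans <|
    (Equiv.sigmaCongrRight fun M =>
      (Equiv.subtypeEquivRight fun x => Subtype.ext_iff).trans (e M)).trans
    (Equiv.sigmaEquivProd _ _)⟩

/-- An equivariant map out of a finite free module is determined by the images of the standard
basis vectors. -/
noncomputable def laurentMapPiEquiv (ι : Type*) [Fintype ι] [DecidableEq ι] :
    LaurentMap K V (ι → K[T;T⁻¹]) ≃ (V ≃ₗ[K] V) × (ι → V) where
  toFun x := (x.1.1, fun i => x.1.2 (Pi.single i 1))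
  invFun y := ⟨(y.1, ∑ i, (laurentAction y.1).toLinearMap.flip (y.2 i) ∘ₗ LinearMap.proj i),
    fun m => by
      simp [laurentAction_T_one_mul, -map_mul, -T_mul]⟩
  left_inv x := by
    refine Subtype.ext (Prod.ext rfl (LinearMap.ext fun m => ?_))
    conv_rhs => rw [pi_eq_sum_univ' m, map_sum]
    simp only [map_smul_eq_laurentAction x.2]
    simp
  right_inv y := by
    refine Prod.ext rfl (funext fun j => ?_)
    simp only [LinearMap.sum_apply, LinearMap.comp_apply, LinearMap.proj_apply,
      LinearMap.flip_apply, AlgHom.toLinearMap_apply]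
    rw [Finset.sum_eq_single j]
    · simp
    · intro i _ hij
      simp [hij]
    · simp

/-- Over a finite field with `q` elements, there are `q ^ (a * k)` submodules of codimension at most
`a` in the free module of rank `k` over Laurent polynomials. -/
theorem card_laurent_submodule_rank_quotient_le [Finite K] (k a : ℕ) :
    Nat.card {M : Submodule K[T;T⁻¹] (Fin k → K[T;T⁻¹]) //
      Module.rank K ((Fin k → K[T;T⁻¹]) ⧸ M.restrictScalars K) ≤ (a : Cardinal)} =
      Nat.card K ^ (a * k) := by
  obtain ⟨e⟩ := nonempty_laurentMap_equiv (K := K) (V := Fin a → K) (N := Fin k → K[T;T⁻¹])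
  have : Finite ((Fin a → K) ≃ₗ[K] (Fin a → K)) :=
    Finite.of_injective _ DFunLike.coe_injective
  have h := Nat.card_congr (e.symm.trans (laurentMapPiEquiv (Fin k)))
  rw [Nat.card_prod, Nat.card_prod, mul_comm] at h
  have h' := Nat.eq_of_mul_eq_mul_left Nat.card_pos h
  rw [Module.finrank_fin_fun] at h'
  rw [h']
  simp [pow_mul, Nat.card_fun]

theorem rank_quotient_restrictScalars_eq_zero_iff {M : Submodule K[T;T⁻¹] N} :
    Module.rank K (N ⧸ M.restrictScalars K) = 0 ↔ M = ⊤ := by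
  rw [rank_zero_iff, Submodule.Quotient.subsingleton_iff,
    Submodule.restrictScalars_eq_top_iff]

end Laurent

theorem Cardinal.le_natCast_succ_iff {c : Cardinal} {n : ℕ} :
    c ≤ ((n + 1 : ℕ) : Cardinal) ↔ c ≤ (n : Cardinal) ∨ c = ((n + 1 : ℕ) : Cardinal) := by
  constructor
  · intro h
    obtain ⟨m, rfl⟩ := Cardinal.lt_aleph0.1 (h.trans_lt Cardinal.natCast_lt_aleph0)
    norm_cast at h ⊢
    omega
  · rintro (h | h)
    · exact h.trans (by exact_mod_cast n.le_succ)
    · exact h.le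

/-- Counting submodules of `R^k`, `R = F_p[x,x⁻¹]`, with `F_p`-codimension `a ≥ 1`:
there are exactly `p^(ak) − p^((a−1)k)` of them; and the only submodule with
`F_p`-codimension `0` is `R^k` itself. -/
theorem stmt7 (p k a : ℕ) [Fact p.Prime] (hk : 1 ≤ k) (ha : 1 ≤ a) :
    Nat.card {M : Submodule (LaurentPolynomial (ZMod p))
        (Fin k → LaurentPolynomial (ZMod p)) //
        Module.rank (ZMod p)
          ((Fin k → LaurentPolynomial (ZMod p)) ⧸ M.restrictScalars (ZMod p))
          = (a : Cardinal)}
      = p ^ (a * k) - p ^ ((a - 1) * k) ∧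
    ∀ M : Submodule (LaurentPolynomial (ZMod p)) (Fin k → LaurentPolynomial (ZMod p)),
      Module.rank (ZMod p)
          ((Fin k → LaurentPolynomial (ZMod p)) ⧸ M.restrictScalars (ZMod p)) = 0
        ↔ M = ⊤ := by
  refine ⟨?_, fun M => rank_quotient_restrictScalars_eq_zero_iff⟩
  obtain ⟨b, rfl⟩ : ∃ b, a = b + 1 := ⟨a - 1, by omega⟩
  have hp : 0 < p := (Fact.out : p.Prime).pos
  let r (M : Submodule (ZMod p)[T;T⁻¹] (Fin k → (ZMod p)[T;T⁻¹])) : Cardinal :=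
    Module.rank (ZMod p) ((Fin k → (ZMod p)[T;T⁻¹]) ⧸ M.restrictScalars (ZMod p))
  have h1 : {M | r M ≤ (b + 1 : ℕ)}.ncard = p ^ ((b + 1) * k) :=
    (Nat.card_coe_set_eq _).symm.trans <|
      (card_laurent_submodule_rank_quotient_le k _).trans (by rw [Nat.card_zmod])
  have h0 : {M | r M ≤ b}.ncard = p ^ (b * k) :=
    (Nat.card_coe_set_eq _).symm.trans <|
      (card_laurent_submodule_rank_quotient_le k _).trans (by rw [Nat.card_zmod])
  have hfin : {M | r M ≤ (b + 1 : ℕ)}.Finite :=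
    Set.finite_of_ncard_pos (h1 ▸ Nat.pow_pos hp)
  have hu : {M | r M ≤ (b + 1 : ℕ)} = {M | r M ≤ b} ∪ {M | r M = (b + 1 : ℕ)} :=
    Set.ext fun M => Cardinal.le_natCast_succ_iff
  have hd : Disjoint {M | r M ≤ b} {M | r M = (b + 1 : ℕ)} := by
    refine Set.disjoint_left.2 fun M (h : r M ≤ b) (h' : r M = (b + 1 : ℕ)) => ?_
    rw [h'] at h
    norm_cast at h
    omega
  rw [hu] at hfin h1
  rw [Set.ncard_union_eq hd (hfin.subset Set.subset_union_left)
    (hfin.subset Set.subset_union_right), h0] at h1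
  change {M | r M = (b + 1 : ℕ)}.ncard = _
  rw [Nat.add_sub_cancel, ← h1, Nat.add_sub_cancel_left]
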